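/- arXiv:2508.15714 — 4 statements merged into one kernel-verified Lean document; each statement's English description precedes it below -/
import Mathlib

section
/- Let r ≥ 1 and e_1 ≥ e_2 ≥ ⋯ ≥ e_r ≥ 1 be integers, and for each j = 1,…,r let f_j(X) = X^{e_j} + b_{j,1}X^{e_j−1} + ⋯ + b_{j,e_j} be a monic polynomial over ℂ[[t]] all of whose non-leading coefficients b_{j,k} lie in the maximal ideal (t). Write the product f = f_1⋯f_r = X^N + a_1X^{N−1} + ⋯ + a_N, where N = e_1 + ⋯ + e_r. Then for every index 1 ≤ i ≤ r such that e_i > e_{i+1} (with the convention e_{r+1} = 0), setting M = e_1 + ⋯ + e_i, one has the congruence a_M ≡ ∏_{j=1}^{i} b_{j,e_j} (mod t^{i+1}). In particular a_M ∈ (t^i), and if each constant term b_{j,e_j} has t-adic order exactly 1, then the lowest-order nonzero term of a_M is t^i times the product over j ≤ i of the coefficients of t in b_{j,e_j}. -/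
/-!
Statement 0 (paper's Lemma "coe of product"):
Let `f_1, …, f_r` be monic polynomials over `ℂ[[t]]` with `deg f_j = e_j`,
`e_1 ≥ e_2 ≥ ⋯ ≥ e_r ≥ 1` (with the convention `e_{r+1} = 0`), all of whose
non-leading coefficients lie in the maximal ideal `(t)`.  Write
`f = f_1 ⋯ f_r = X^N + a_1 X^{N-1} + ⋯ + a_N`.  Then for every `1 ≤ i ≤ r` with
`e_i > e_{i+1}`, setting `M = e_1 + ⋯ + e_i` (so that `a_M` is the coefficient of
`X^{N-M}` in `f`), one has `a_M ≡ ∏_{j ≤ i} b_{j,e_j} (mod t^{i+1})` where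
`b_{j,e_j} = f_j(0)` is the constant term of `f_j`.  In particular `a_M ∈ (t^i)`,
and if each `b_{j,e_j}` has `t`-adic order exactly `1`, then the lowest-order
nonzero term of `a_M` is `t^i` times the product over `j ≤ i` of the coefficients
of `t` in the `b_{j,e_j}`.
-/

open Polynomial in
/-- If the coefficients of each factor below degree `d` lie in `I`, then a coefficient of the
product in degree less than `d * (u + 1)` lies in `I ^ (#s - u)`. -/
theorem Polynomial.coeff_prod_mem_pow_of_coeff_mem_of_lt {R ι : Type*} [CommRing R] (I : Ideal R)
    (f : ι → R[X]) (d : ℕ) (s : Finset ι) (hf : ∀ j ∈ s, ∀ k < d, (f j).coeff k ∈ I)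
    {p u : ℕ} (hp : p < d * (u + 1)) : (∏ j ∈ s, f j).coeff p ∈ I ^ (s.card - u) := by
  classical
  induction s using Finset.induction_on generalizing p u with
  | empty => simp
  | insert a s ha ih =>
    have hs : ∀ j ∈ s, ∀ k < d, (f j).coeff k ∈ I :=
      fun j hj ↦ hf j (Finset.mem_insert_of_mem hj)
    rw [Finset.prod_insert ha, Finset.card_insert_of_notMem ha, coeff_mul]
    refine Ideal.sum_mem _ fun ⟨x, y⟩ hxy ↦ ?_
    rw [Finset.HasAntidiagonal.mem_antidiagonal] at hxy
    dsimp only at hxy ⊢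
    rcases lt_or_ge x d with hx | hx
    · have h := Ideal.mul_mem_mul (hf a (Finset.mem_insert_self a s) x hx)
        (ih hs (p := y) (u := u) (by omega))
      rw [← pow_succ'] at h
      exact Ideal.pow_le_pow_right (by omega) h
    · obtain _ | u := u
      · omega
      · rw [mul_add, mul_one] at hp
        exact Ideal.pow_le_pow_right (by omega)
          (Ideal.mul_mem_left _ _ (ih hs (p := y) (u := u) (by omega)))

open Polynomial in
/-- If each factor has degree at most `e j ≤ d` and its coefficients below degree `e j` lie in `I`,
then a coefficient of the product lying more than `d * (c - 1)` below the top degree is in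
`I ^ c`. -/
theorem Polynomial.coeff_prod_mem_pow_of_add_lt {R ι : Type*} [CommRing R] (I : Ideal R)
    (f : ι → R[X]) (e : ι → ℕ) (d : ℕ) (s : Finset ι) (hed : ∀ j ∈ s, e j ≤ d)
    (hdeg : ∀ j ∈ s, (f j).natDegree ≤ e j) (hf : ∀ j ∈ s, ∀ k < e j, (f j).coeff k ∈ I)
    {q c : ℕ} (hq : q + d * c < ∑ j ∈ s, e j + d) : (∏ j ∈ s, f j).coeff q ∈ I ^ c := by
  classical
  induction s using Finset.induction_on generalizing q c with
  | empty =>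
    obtain _ | c := c
    · simp
    · rw [Finset.sum_empty, mul_add, mul_one] at hq
      omega
  | insert a s ha ih =>
    rw [Finset.forall_mem_insert] at hed hdeg hf
    rw [Finset.sum_insert ha] at hq
    rw [Finset.prod_insert ha, coeff_mul]
    refine Ideal.sum_mem _ fun ⟨x, y⟩ hxy ↦ ?_
    rw [Finset.HasAntidiagonal.mem_antidiagonal] at hxy
    dsimp only at hxy ⊢
    have ih := fun {q c : ℕ} ↦ @ih hed.2 hdeg.2 hf.2 q c
    rcases lt_trichotomy x (e a) with hx | hx | hx
    · obtain _ | c := c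
      · simp
      · rw [mul_add, mul_one] at hq
        rw [pow_succ']
        exact Ideal.mul_mem_mul (hf.1 x hx) (ih (by have := hed.1; omega))
    · exact Ideal.mul_mem_left _ _ (ih (by omega))
    · rw [coeff_eq_zero_of_natDegree_lt (hdeg.1.trans_lt hx), zero_mul]
      exact Ideal.zero_mem _

open Polynomial in
/-- For monic polynomials with non-leading coefficients in `I`, those indexed by `s` having degree
greater than `d` and those indexed by `t` having degree at most `d`, the coefficient of the product
in degree `∑ j ∈ t, e j` is the product over `s` of the constant terms modulo `I ^ (#s + 1)`. -/
theorem Polynomial.coeff_prod_mul_prod_sub_mem_pow {R ι : Type*} [CommRing R] (I : Ideal R)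
    (f : ι → R[X]) (e : ι → ℕ) (d : ℕ) (s t : Finset ι)
    (hs : ∀ j ∈ s, d < e j) (hfs : ∀ j ∈ s, ∀ k < e j, (f j).coeff k ∈ I)
    (ht : ∀ j ∈ t, e j ≤ d) (hft : ∀ j ∈ t, ∀ k < e j, (f j).coeff k ∈ I)
    (hmonic : ∀ j ∈ t, (f j).Monic) (hdeg : ∀ j ∈ t, (f j).natDegree = e j) :
    ((∏ j ∈ s, f j) * ∏ j ∈ t, f j).coeff (∑ j ∈ t, e j) - ∏ j ∈ s, (f j).coeff 0
      ∈ I ^ (s.card + 1) := by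
  have htop : (∏ j ∈ t, f j).coeff (∑ j ∈ t, e j) = 1 := by
    have h := monic_prod_of_monic t f hmonic
    rw [← Finset.sum_congr rfl hdeg, ← natDegree_prod_of_monic t f hmonic]
    exact h
  rw [coeff_mul, ← Finset.add_sum_erase _ _
    (show (0, ∑ j ∈ t, e j) ∈ Finset.HasAntidiagonal.antidiagonal (∑ j ∈ t, e j) by simp),
    htop, mul_one, coeff_zero_prod, add_sub_cancel_left]
  refine Ideal.sum_mem _ fun ⟨p, q⟩ hpq ↦ ?_
  simp only [Finset.mem_erase, Finset.HasAntidiagonal.mem_antidiagonal, ne_eq,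
    Prod.mk.injEq] at hpq ⊢
  have hp : 0 < p := by omega
  obtain ⟨u, hu₁, hu₂⟩ : ∃ u, (d + 1) * u ≤ p ∧ p < (d + 1) * (u + 1) :=
    ⟨p / (d + 1), Nat.mul_div_le _ _, Nat.lt_mul_div_succ _ d.succ_pos⟩
  have hA := coeff_prod_mem_pow_of_coeff_mem_of_lt I f (d + 1) s
    (fun j hj k hk ↦ hfs j hj k (hk.trans_le (hs j hj))) hu₂
  have hB : (∏ j ∈ t, f j).coeff q ∈ I ^ (u + 1) := by
    refine coeff_prod_mem_pow_of_add_lt I f e d t ht (fun j hj ↦ (hdeg j hj).le) hft ?_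
    obtain rfl | hu := Nat.eq_zero_or_pos u
    · omega
    · rw [mul_add, mul_one]
      rw [add_mul, one_mul] at hu₁
      omega
  have h := Ideal.mul_mem_mul hA hB
  rw [← pow_add] at h
  exact Ideal.pow_le_pow_right (by omega) h

/-- A product of `#s` power series without constant term is `X ^ #s` times a power series whose
constant term is the product of the coefficients of `X`. -/
theorem PowerSeries.exists_prod_eq_X_pow_mul {R ι : Type*} [CommRing R] (b : ι → PowerSeries R)
    (s : Finset ι) (hb : ∀ j ∈ s, PowerSeries.constantCoeff (b j) = 0) :
    ∃ g : PowerSeries R, ∏ j ∈ s, b j = PowerSeries.X ^ s.card * g ∧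
      PowerSeries.constantCoeff g = ∏ j ∈ s, PowerSeries.coeff 1 (b j) := by
  have h : ∀ j ∈ s, ∃ g : PowerSeries R, b j = PowerSeries.X * g :=
    fun j hj ↦ PowerSeries.X_dvd_iff.2 (hb j hj)
  choose! g hg using h
  refine ⟨∏ j ∈ s, g j, ?_, ?_⟩
  · rw [Finset.prod_congr rfl hg, Finset.prod_mul_distrib, Finset.prod_const]
  · rw [map_prod]
    refine Finset.prod_congr rfl fun j hj ↦ ?_
    rw [hg j hj, ← zero_add 1, PowerSeries.coeff_succ_X_mul,
      PowerSeries.coeff_zero_eq_constantCoeff_apply]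

theorem leading_coeff_of_product_of_eisenstein
    (r : ℕ) (hr : 1 ≤ r)
    (e : ℕ → ℕ)
    (hpos : ∀ j, 1 ≤ j → j ≤ r → 1 ≤ e j)
    (hanti : ∀ j, 1 ≤ j → j < r → e (j + 1) ≤ e j)
    (hconv : e (r + 1) = 0)
    (f : ℕ → Polynomial (PowerSeries ℂ))
    (hmonic : ∀ j ∈ Finset.Icc 1 r, (f j).Monic)
    (hdeg : ∀ j ∈ Finset.Icc 1 r, (f j).natDegree = e j)
    (heis : ∀ j ∈ Finset.Icc 1 r, ∀ k < e j,
      PowerSeries.constantCoeff ((f j).coeff k) = 0)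
    (i : ℕ) (hi1 : 1 ≤ i) (hir : i ≤ r)
    (hgap : e (i + 1) < e i) :
    -- `a_M`, the coefficient of `X^{N-M}` in the product, is congruent to the
    -- product of the constant terms `b_{j,e_j} = (f j).coeff 0`, `j ≤ i`, mod `(t)^{i+1}`:
    ((∏ j ∈ Finset.Icc 1 r, f j).coeff
        ((∑ j ∈ Finset.Icc 1 r, e j) - ∑ j ∈ Finset.Icc 1 i, e j)
      - ∏ j ∈ Finset.Icc 1 i, (f j).coeff 0)
      ∈ (Ideal.span {(PowerSeries.X : PowerSeries ℂ)}) ^ (i + 1)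
    ∧
    -- in particular `a_M ∈ (t^i)`:
    ((∏ j ∈ Finset.Icc 1 r, f j).coeff
        ((∑ j ∈ Finset.Icc 1 r, e j) - ∑ j ∈ Finset.Icc 1 i, e j))
      ∈ (Ideal.span {(PowerSeries.X : PowerSeries ℂ)}) ^ i
    ∧
    -- and if each constant term `b_{j,e_j}` has `t`-adic order exactly `1`
    -- (its constant coefficient vanishes by `heis`, so this says the coefficient of
    -- `t` is nonzero), then the lowest-order nonzero term of `a_M` is `t^i` times the
    -- product of the coefficients of `t` in the `b_{j,e_j}`:
    ((∀ j ∈ Finset.Icc 1 i, PowerSeries.coeff 1 ((f j).coeff 0) ≠ 0) →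
      (∀ k < i, PowerSeries.coeff k
        ((∏ j ∈ Finset.Icc 1 r, f j).coeff
          ((∑ j ∈ Finset.Icc 1 r, e j) - ∑ j ∈ Finset.Icc 1 i, e j)) = 0)
      ∧ PowerSeries.coeff i
          ((∏ j ∈ Finset.Icc 1 r, f j).coeff
            ((∑ j ∈ Finset.Icc 1 r, e j) - ∑ j ∈ Finset.Icc 1 i, e j))
        = ∏ j ∈ Finset.Icc 1 i, PowerSeries.coeff 1 ((f j).coeff 0)
      ∧ PowerSeries.coeff i
          ((∏ j ∈ Finset.Icc 1 r, f j).coeff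
            ((∑ j ∈ Finset.Icc 1 r, e j) - ∑ j ∈ Finset.Icc 1 i, e j)) ≠ 0) := by
  have hunion : Finset.Icc 1 r = Finset.Icc 1 i ∪ Finset.Icc (i + 1) r := by
    ext j; simp only [Finset.mem_union, Finset.mem_Icc]; omega
  have hdisj : Disjoint (Finset.Icc 1 i) (Finset.Icc (i + 1) r) :=
    Finset.disjoint_left.2 fun j hj hj' ↦ by rw [Finset.mem_Icc] at hj hj'; omega
  have hsub₁ : Finset.Icc 1 i ⊆ Finset.Icc 1 r := Finset.Icc_subset_Icc_right hir
  have hsub₂ : Finset.Icc (i + 1) r ⊆ Finset.Icc 1 r := Finset.Icc_subset_Icc_left (by omega)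
  have hmono : ∀ j k, 1 ≤ j → j ≤ k → k ≤ r → e k ≤ e j := by
    intro j k hj hjk
    induction k, hjk using Nat.le_induction with
    | base => exact fun _ ↦ le_rfl
    | succ k hjk ih => exact fun hk ↦ (hanti k (by omega) hk).trans (ih (by omega))
  have hI : ∀ j ∈ Finset.Icc 1 r, ∀ k < e j,
      (f j).coeff k ∈ Ideal.span {(PowerSeries.X : PowerSeries ℂ)} := fun j hj k hk ↦
    Ideal.mem_span_singleton.2 (PowerSeries.X_dvd_iff.2 (heis j hj k hk))
  have hmain := Polynomial.coeff_prod_mul_prod_sub_mem_pow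
    (Ideal.span {(PowerSeries.X : PowerSeries ℂ)}) f e (e (i + 1)) (Finset.Icc 1 i)
    (Finset.Icc (i + 1) r)
    (fun j hj ↦ hgap.trans_le (by rw [Finset.mem_Icc] at hj; exact hmono j i hj.1 hj.2 hir))
    (fun j hj ↦ hI j (hsub₁ hj))
    (fun j hj ↦ by rw [Finset.mem_Icc] at hj; exact hmono (i + 1) j (by omega) hj.1 hj.2)
    (fun j hj ↦ hI j (hsub₂ hj)) (fun j hj ↦ hmonic j (hsub₂ hj)) (fun j hj ↦ hdeg j (hsub₂ hj))
  obtain ⟨g, hg, hg₀⟩ := PowerSeries.exists_prod_eq_X_pow_mul (fun j ↦ (f j).coeff 0)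
    (Finset.Icc 1 i) fun j hj ↦ heis j (hsub₁ hj) 0
      (hpos j (Finset.mem_Icc.1 hj).1 (Finset.mem_Icc.1 (hsub₁ hj)).2)
  rw [← Finset.prod_union hdisj, ← hunion, Nat.card_Icc, Nat.add_sub_cancel] at hmain
  rw [Nat.card_Icc, Nat.add_sub_cancel] at hg
  rw [show ∑ j ∈ Finset.Icc 1 r, e j - ∑ j ∈ Finset.Icc 1 i, e j =
    ∑ j ∈ Finset.Icc (i + 1) r, e j by rw [hunion, Finset.sum_union hdisj, Nat.add_sub_cancel_left]]
  generalize (∏ j ∈ Finset.Icc 1 r, f j).coeff (∑ j ∈ Finset.Icc (i + 1) r, e j) = a at hmain ⊢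
  refine ⟨hmain, ?_⟩
  rw [Ideal.span_singleton_pow, Ideal.mem_span_singleton, hg] at hmain
  have ha : PowerSeries.X ^ i ∣ a :=
    (dvd_sub_left (dvd_mul_right _ g)).1 ((pow_dvd_pow _ i.le_succ).trans hmain)
  have hcoeff : PowerSeries.coeff i a =
      ∏ j ∈ Finset.Icc 1 i, PowerSeries.coeff 1 ((f j).coeff 0) := by
    have h := PowerSeries.X_pow_dvd_iff.1 hmain i i.lt_succ_self
    rw [map_sub, sub_eq_zero] at h
    rw [h, ← hg₀, PowerSeries.coeff_X_pow_mul', if_pos le_rfl, Nat.sub_self,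
      PowerSeries.coeff_zero_eq_constantCoeff_apply]
  refine ⟨by rwa [Ideal.span_singleton_pow, Ideal.mem_span_singleton], fun hne ↦ ?_⟩
  exact ⟨PowerSeries.X_pow_dvd_iff.1 ha, hcoeff, hcoeff ▸ Finset.prod_ne_zero_iff.2 hne⟩
end

section
/- Let e ≥ 1. In the polynomial ring R = ℂ[y_0,…,y_e], for 0 ≤ m ≤ 2e set c_m = Σ_{i+j=m, 0≤i,j≤e} y_i y_j, and let Q_e ⊆ R be the ℂ-subalgebra generated by c_0,…,c_{2e}. Then each variable y_i (0 ≤ i ≤ e) is integral over Q_e; consequently R = ℂ[y_0,…,y_e] is a finitely generated Q_e-module. -/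
/-!
Statement 4 (first claim of the paper's Lemma "single normalization"):
In `R = ℂ[y₀,…,y_e]`, let `c_m = Σ_{i+j=m} y_i y_j` (for `0 ≤ m ≤ 2e`) and let
`Q_e` be the subalgebra generated by `c_0, …, c_{2e}` (so `(Σ y_i λ^i)² = Σ c_m λ^m`).
Then each variable `y_i` is integral over `Q_e`; consequently `R` is a finitely
generated `Q_e`-module.
-/

noncomputable section

/-- The variable `y_i` of `ℂ[y₀,…,y_e]` (and `0` if `i > e`). -/
def yVar (e i : ℕ) : MvPolynomial (Fin (e + 1)) ℂ :=
  if h : i ≤ e then MvPolynomial.X ⟨i, Nat.lt_succ_of_le h⟩ else 0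

/-- `c_m = Σ_{i+j=m, 0 ≤ i,j ≤ e} y_i y_j`. -/
def cCoeff (e m : ℕ) : MvPolynomial (Fin (e + 1)) ℂ :=
  ∑ p ∈ Finset.HasAntidiagonal.antidiagonal m, yVar e p.1 * yVar e p.2

/-- `Q_e`: the subalgebra of `ℂ[y₀,…,y_e]` generated by `c_0, …, c_{2e}`. -/
def Qe (e : ℕ) : Subalgebra ℂ (MvPolynomial (Fin (e + 1)) ℂ) :=
  Algebra.adjoin ℂ ((fun m => cCoeff e m) '' {m : ℕ | m ≤ 2 * e})

open Polynomial in
/-- If every coefficient of `f ^ n` lies in the subalgebra `S`, then every coefficient of `f` is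
integral over `S`. -/
theorem Polynomial.isIntegral_coeff_of_coeff_pow_mem {R A : Type*} [CommRing R] [CommRing A]
    [Algebra R A] (S : Subalgebra R A) {f : A[X]} {n : ℕ} (hn : 0 < n)
    (hf : ∀ m, (f ^ n).coeff m ∈ S) (i : ℕ) : IsIntegral S (f.coeff i) := by
  let : Algebra S[X] A[X] := Polynomial.algebra S A
  have hlift : f ^ n ∈ Polynomial.lifts (algebraMap S A) :=
    (Polynomial.lifts_iff_coeff_lifts _).2 fun m => ⟨⟨_, hf m⟩, rfl⟩
  obtain ⟨g, hg⟩ := hlift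
  refine Polynomial.isIntegral_iff_isIntegral_coeff.1 (IsIntegral.of_pow hn ?_) i
  rw [← hg]
  exact isIntegral_algebraMap (R := S[X]) (A := A[X]) (x := g)

theorem yVar_eq_zero {e i : ℕ} (h : e < i) : yVar e i = 0 :=
  dif_neg (not_le.2 h)

theorem yVar_fin {e : ℕ} (i : Fin (e + 1)) : yVar e i = MvPolynomial.X i :=
  dif_pos (Nat.lt_succ_iff.1 i.2)

theorem cCoeff_eq_zero {e m : ℕ} (h : 2 * e < m) : cCoeff e m = 0 := by
  refine Finset.sum_eq_zero fun p hp => ?_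
  rw [Finset.HasAntidiagonal.mem_antidiagonal] at hp
  rcases lt_or_ge e p.1 with h1 | h1
  · rw [yVar_eq_zero h1, zero_mul]
  · rw [yVar_eq_zero (i := p.2) (by lia), mul_zero]

theorem cCoeff_mem_Qe (e m : ℕ) : cCoeff e m ∈ Qe e := by
  rcases le_or_gt m (2 * e) with h | h
  · exact Algebra.subset_adjoin ⟨m, h, rfl⟩
  · rw [cCoeff_eq_zero h]
    exact zero_mem _

/-- The generic polynomial `∑ y_i λ^i` of degree `e`. -/
def genericPoly (e : ℕ) : Polynomial (MvPolynomial (Fin (e + 1)) ℂ) :=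
  ∑ i ∈ Finset.range (e + 1), Polynomial.monomial i (yVar e i)

theorem coeff_genericPoly (e i : ℕ) : (genericPoly e).coeff i = yVar e i := by
  simp only [genericPoly, Polynomial.finsetSum_coeff, Polynomial.coeff_monomial,
    Finset.sum_ite_eq', Finset.mem_range]
  split_ifs with h
  · rfl
  · exact (yVar_eq_zero (by lia)).symm

theorem coeff_genericPoly_sq (e m : ℕ) : (genericPoly e ^ 2).coeff m = cCoeff e m := by
  simp only [sq, Polynomial.coeff_mul, coeff_genericPoly, cCoeff]

theorem isIntegral_X_over_Qe (e : ℕ) (i : Fin (e + 1)) :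
    IsIntegral (Qe e) (MvPolynomial.X i : MvPolynomial (Fin (e + 1)) ℂ) := by
  rw [← yVar_fin, ← coeff_genericPoly]
  refine Polynomial.isIntegral_coeff_of_coeff_pow_mem _ two_pos (fun m => ?_) i
  rw [coeff_genericPoly_sq]
  exact cCoeff_mem_Qe e m

theorem variables_integral_over_Qe (e : ℕ) (he : 1 ≤ e) :
    (∀ i : Fin (e + 1),
      IsIntegral ↥(Qe e) (MvPolynomial.X i : MvPolynomial (Fin (e + 1)) ℂ))
    ∧ Module.Finite ↥(Qe e) (MvPolynomial (Fin (e + 1)) ℂ) := by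
  refine ⟨isIntegral_X_over_Qe e, ?_⟩
  have hint : Algebra.IsIntegral (Qe e) (MvPolynomial (Fin (e + 1)) ℂ) := by
    refine ⟨fun p => ?_⟩
    induction p using MvPolynomial.induction_on with
    | C a => exact isIntegral_algebraMap (x := algebraMap ℂ (Qe e) a)
    | add p q hp hq => exact hp.add hq
    | mul_X p i hp => exact hp.mul (isIntegral_X_over_Qe e i)
  have : Algebra.FiniteType (Qe e) (MvPolynomial (Fin (e + 1)) ℂ) :=
    Algebra.FiniteType.of_restrictScalars_finiteType ℂ _ _
  exact Algebra.IsIntegral.finite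

end
end

section
/- Let ℓ ≥ 1 and e_1,…,e_ℓ ≥ 1 be integers. Let A be the polynomial ring over ℂ in the variables y_{i,j} (1 ≤ i ≤ ℓ, 0 ≤ j ≤ e_i) subject to the identifications y_{i,e_i} = y_{i+1,0} for 1 ≤ i ≤ ℓ−1 (so A is a polynomial ring in 1 + e_1 + ⋯ + e_ℓ variables). For each 1 ≤ i ≤ ℓ and 0 ≤ m ≤ 2e_i set c^{(i)}_m = Σ_{j+k=m, 0≤j,k≤e_i} y_{i,j} y_{i,k}, let CQ ⊆ A be the ℂ-subalgebra generated by all the c^{(i)}_m, and let V ⊆ A be the degree-2 Veronese subalgebra generated by all products of two variables. Then V is the integral closure of CQ in its field of fractions; precisely: (i) every element of V is integral over CQ; (ii) CQ and V have the same field of fractions inside Frac(A); and (iii) V is integrally closed in its field of fractions. -/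
/-!
Statement 7 (paper's Lemma on chained Veronese rings, part (1)):
Let `A` be the polynomial ring over `ℂ` in `1 + e₁ + ⋯ + e_ℓ` variables, thought of as
the chained variables `y_{i,0}, …, y_{i,e_i}` (`1 ≤ i ≤ ℓ`) with the identification
`y_{i,e_i} = y_{i+1,0}` (realized here by numbering the variables globally:
`y_{i,j}` is the variable with index `e₁ + ⋯ + e_{i-1} + j`).  For each chain `i` set
`c^{(i)}_m = Σ_{j+k=m, 0 ≤ j,k ≤ e_i} y_{i,j} y_{i,k}` (`0 ≤ m ≤ 2 e_i`), let `CQ` be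
the subalgebra generated by all the `c^{(i)}_m`, and let `V` be the degree-2 Veronese
subalgebra of `A` (generated by all products of two variables).  Then `V` is the
integral closure of `CQ` in its field of fractions: (i) every element of `V` is
integral over `CQ`; (ii) `CQ` and `V` have the same field of fractions inside
`Frac(A)`; (iii) `V` is integrally closed in its field of fractions.
-/

noncomputable section

/-- The total number of variables: `1 + e₁ + ⋯ + e_ℓ`. -/
def nVars (ℓ : ℕ) (e : ℕ → ℕ) : ℕ := 1 + ∑ k ∈ Finset.Icc 1 ℓ, e k

/-- The chained variable `y_{i,j}`: the variable of global index
`e₁ + ⋯ + e_{i-1} + j` (and `0` if that index is out of range); in particular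
`y_{i,e_i} = y_{i+1,0}`. -/
def chY (ℓ : ℕ) (e : ℕ → ℕ) (i j : ℕ) : MvPolynomial (Fin (nVars ℓ e)) ℂ :=
  if h : (∑ k ∈ Finset.Ico 1 i, e k) + j < nVars ℓ e then MvPolynomial.X ⟨_, h⟩ else 0

/-- `c^{(i)}_m = Σ_{j+k=m, 0 ≤ j,k ≤ e_i} y_{i,j} y_{i,k}`, the coefficients of
`(Σ_j y_{i,j} λ^j)²`. -/
def chC (ℓ : ℕ) (e : ℕ → ℕ) (i m : ℕ) : MvPolynomial (Fin (nVars ℓ e)) ℂ :=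
  ∑ p ∈ Finset.HasAntidiagonal.antidiagonal m,
    (if p.1 ≤ e i then chY ℓ e i p.1 else 0) * (if p.2 ≤ e i then chY ℓ e i p.2 else 0)

/-- `CQ`: the chained subalgebra, generated by all the `c^{(i)}_m`,
`1 ≤ i ≤ ℓ`, `0 ≤ m ≤ 2 e_i`. -/
def CQ (ℓ : ℕ) (e : ℕ → ℕ) : Subalgebra ℂ (MvPolynomial (Fin (nVars ℓ e)) ℂ) :=
  Algebra.adjoin ℂ
    {x | ∃ i m : ℕ, 1 ≤ i ∧ i ≤ ℓ ∧ m ≤ 2 * e i ∧ x = chC ℓ e i m}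

/-- The degree-2 Veronese subalgebra of `A`, generated by all products of two
variables. -/
def chV (ℓ : ℕ) (e : ℕ → ℕ) : Subalgebra ℂ (MvPolynomial (Fin (nVars ℓ e)) ℂ) :=
  Algebra.adjoin ℂ
    {x | ∃ a b : Fin (nVars ℓ e), x = MvPolynomial.X a * MvPolynomial.X b}

/-- If all coefficients of `p ^ 2` are integral over `R`, so are those of `p`. -/
lemma isIntegral_coeff_of_coeff_sq {R S : Type*} [CommRing R] [CommRing S] [Algebra R S]
    (p : Polynomial S) (h : ∀ m, IsIntegral R ((p ^ 2).coeff m)) (j : ℕ) :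
    IsIntegral R (p.coeff j) := by
  let _ := (Polynomial.mapRingHom (algebraMap R S)).toAlgebra
  exact Polynomial.isIntegral_iff_isIntegral_coeff.mp
    (IsIntegral.of_pow two_pos (Polynomial.isIntegral_iff_isIntegral_coeff.mpr h)) j

/-- A subfield containing all coefficients of the square of the power series `∑ z_k λ^k`
contains all the products `z_0 z_k`. -/
lemma mul_mem_of_sum_antidiagonal_mem {F : Type*} [Field F] [CharZero F] (K : Subfield F)
    (z : ℕ → F) (h0 : z 0 ≠ 0)
    (h : ∀ m, ∑ p ∈ Finset.HasAntidiagonal.antidiagonal m, z p.1 * z p.2 ∈ K) (k : ℕ) : z 0 * z k ∈ K := by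
  have hsq : z 0 * z 0 ∈ K := by simpa using h 0
  induction k using Nat.strong_induction_on with
  | _ k ih =>
    rcases k with _ | k
    · exact hsq
    have hk := h (k + 1)
    rw [Finset.Nat.sum_antidiagonal_succ] at hk
    rcases k with _ | k
    · simp only [zero_add, Finset.Nat.antidiagonal_zero, Finset.sum_singleton] at hk ⊢
      have : z 0 * z 1 = (z 0 * z 1 + z 1 * z 0) / 2 := by field_simp; ring
      rw [this]
      exact K.div_mem hk (ofNat_mem K 2)
    rw [Finset.Nat.sum_antidiagonal_succ'] at hk
    set s := ∑ p ∈ Finset.HasAntidiagonal.antidiagonal k, z (p.1 + 1) * z (p.2 + 1) with hs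
    have hmem : z 0 * z 0 * s ∈ K := by
      rw [hs, Finset.mul_sum]
      refine sum_mem fun p hp => ?_
      have hp' := Finset.HasAntidiagonal.mem_antidiagonal.mp hp
      have := K.mul_mem (ih (p.1 + 1) (by omega)) (ih (p.2 + 1) (by omega))
      convert this using 1
      ring
    have hsK : s ∈ K := by
      have := K.div_mem hmem hsq
      rwa [mul_div_cancel_left₀ _ (mul_ne_zero h0 h0)] at this
    have key := K.div_mem (K.sub_mem hk hsK) (ofNat_mem K 2)
    convert key using 1
    field_simp
    ring

/-- The involution `y ↦ -y` of a polynomial ring. -/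
def MvPolynomial.negVars (σ : Type*) : MvPolynomial σ ℂ →ₐ[ℂ] MvPolynomial σ ℂ :=
  MvPolynomial.aeval fun a => -MvPolynomial.X a

/-- The degree-2 Veronese subalgebra contains the even monomials, and the odd ones after
multiplication by a variable. -/
lemma monomial_mem_adjoin_X_mul_X {σ : Type*} (d : σ →₀ ℕ) :
    let V := Algebra.adjoin ℂ
      {x : MvPolynomial σ ℂ | ∃ a b, x = MvPolynomial.X a * MvPolynomial.X b}
    (Even d.degree → MvPolynomial.monomial d 1 ∈ V) ∧
      (Odd d.degree → ∀ a, MvPolynomial.X a * MvPolynomial.monomial d 1 ∈ V) := by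
  intro V
  have hX : ∀ a b : σ, (MvPolynomial.X a * MvPolynomial.X b : MvPolynomial σ ℂ) ∈ V :=
    fun a b => Algebra.subset_adjoin ⟨a, b, rfl⟩
  classical
  induction hn : d.degree generalizing d with
  | zero =>
    obtain rfl : d = 0 := (Finsupp.degree_eq_zero_iff d).mp hn
    exact ⟨fun _ => one_mem V, fun h => by simp at h⟩
  | succ n ih =>
    obtain ⟨b, hb⟩ : ∃ b, d b ≠ 0 := by
      by_contra! h
      obtain rfl : d = 0 := Finsupp.ext h
      simp at hn
    obtain ⟨d', rfl⟩ : ∃ d', d = Finsupp.single b 1 + d' :=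
      exists_add_of_le (Finsupp.single_le_iff.mpr (Nat.one_le_iff_ne_zero.mpr hb))
    have hmul : (MvPolynomial.monomial (Finsupp.single b 1 + d') 1 : MvPolynomial σ ℂ) =
        MvPolynomial.X b * MvPolynomial.monomial d' 1 := by
      rw [MvPolynomial.X, MvPolynomial.monomial_mul, one_mul]
    rw [map_add, Finsupp.degree_single] at hn
    obtain ⟨h1, h2⟩ := ih d' (by omega)
    rw [hmul]
    refine ⟨fun h => h2 ?_ b, fun h a => ?_⟩
    · rwa [Nat.even_add_one, Nat.not_even_iff_odd] at h
    · rw [Nat.odd_add_one, Nat.not_odd_iff_even] at h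
      rw [← mul_assoc]
      exact mul_mem (hX a b) (h1 h)

/-- A polynomial invariant under `y ↦ -y` lies in the degree-2 Veronese subalgebra. -/
lemma mem_adjoin_X_mul_X_of_negVars_eq {σ : Type*} {f : MvPolynomial σ ℂ}
    (hf : MvPolynomial.negVars σ f = f) :
    f ∈ Algebra.adjoin ℂ
      {x : MvPolynomial σ ℂ | ∃ a b, x = MvPolynomial.X a * MvPolynomial.X b} := by
  have hcoeff : ∀ (g : MvPolynomial σ ℂ) (d : σ →₀ ℕ),
      (MvPolynomial.negVars σ g).coeff d = (-1) ^ d.degree * g.coeff d := by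
    intro g d
    classical
    induction g using MvPolynomial.induction_on' with
    | monomial u c =>
      have : MvPolynomial.negVars σ (MvPolynomial.monomial u c) =
          MvPolynomial.monomial u ((-1) ^ u.degree * c) := by
        rw [MvPolynomial.negVars, MvPolynomial.aeval_monomial, MvPolynomial.monomial_eq,
          MvPolynomial.algebraMap_eq, Finsupp.degree_apply]
        simp only [Finsupp.prod, fun (a : σ) (k : ℕ) =>
          neg_pow (MvPolynomial.X a : MvPolynomial σ ℂ) k, Finset.prod_mul_distrib,
          Finset.prod_pow_eq_pow_sum, map_mul, map_pow, map_neg, map_one]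
        ring
      rw [this, MvPolynomial.coeff_monomial, MvPolynomial.coeff_monomial]
      split_ifs with h
      · rw [h]
      · rw [mul_zero]
    | add p q hp hq => rw [map_add, MvPolynomial.coeff_add, MvPolynomial.coeff_add, hp, hq, mul_add]
  rw [f.as_sum]
  refine sum_mem fun d hd => ?_
  have hd' := MvPolynomial.mem_support_iff.mp hd
  have heven : Even d.degree := by
    by_contra hodd
    have := hcoeff f d
    rw [hf, (Nat.not_even_iff_odd.mp hodd).neg_one_pow] at this
    exact hd' (by linear_combination this / 2)
  have := (monomial_mem_adjoin_X_mul_X d).1 heven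
  have h2 := Subalgebra.smul_mem _ this (f.coeff d)
  rwa [MvPolynomial.smul_monomial, smul_eq_mul, mul_one] at h2

/-- The degree-2 Veronese subalgebra is fixed by `y ↦ -y`. -/
lemma negVars_eq_of_mem_adjoin_X_mul_X {σ : Type*} {f : MvPolynomial σ ℂ}
    (hf : f ∈ Algebra.adjoin ℂ
      {x : MvPolynomial σ ℂ | ∃ a b, x = MvPolynomial.X a * MvPolynomial.X b}) :
    MvPolynomial.negVars σ f = f := by
  induction hf using Algebra.adjoin_induction with
  | mem x hx => obtain ⟨a, b, rfl⟩ := hx; simp [MvPolynomial.negVars]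
  | algebraMap r => simp
  | add x y _ _ hx hy => rw [map_add, hx, hy]
  | mul x y _ _ hx hy => rw [map_mul, hx, hy]

/-- The degree-2 Veronese subalgebra is integrally closed. -/
lemma isIntegrallyClosed_adjoin_X_mul_X (σ : Type*) :
    IsIntegrallyClosed (Algebra.adjoin ℂ
      {x : MvPolynomial σ ℂ | ∃ a b, x = MvPolynomial.X a * MvPolynomial.X b}) := by
  set V := Algebra.adjoin ℂ
      {x : MvPolynomial σ ℂ | ∃ a b, x = MvPolynomial.X a * MvPolynomial.X b}
  rw [isIntegrallyClosed_iff (FractionRing V)]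
  intro x hx
  let L := FractionRing (MvPolynomial σ ℂ)
  have hinj : Function.Injective (algebraMap V L) :=
    (IsFractionRing.injective (MvPolynomial σ ℂ) L).comp Subtype.val_injective
  let φ : FractionRing V →ₐ[V] L := IsFractionRing.liftAlgHom (g := Algebra.ofId V L) hinj
  obtain ⟨f, hf⟩ := (IsIntegrallyClosed.isIntegral_iff (R := MvPolynomial σ ℂ) (K := L)).mp
    ((hx.map φ).tower_top)
  obtain ⟨p, q, hq, rfl⟩ := IsFractionRing.div_surjective (A := V) x
  have hq0 : q ≠ 0 := nonZeroDivisors.ne_zero hq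
  have hq0' : (q : MvPolynomial σ ℂ) ≠ 0 := fun h => hq0 (Subtype.ext h)
  have hmul : f * q = p := by
    apply IsFractionRing.injective (MvPolynomial σ ℂ) L
    rw [map_div₀, AlgHom.commutes, AlgHom.commutes, eq_div_iff
      ((map_ne_zero_iff _ hinj).mpr hq0)] at hf
    rw [map_mul]
    exact hf
  have hfV : f ∈ V := by
    apply mem_adjoin_X_mul_X_of_negVars_eq
    apply mul_right_cancel₀ hq0'
    rw [hmul]
    have h := congrArg (MvPolynomial.negVars σ) hmul
    rwa [map_mul, negVars_eq_of_mem_adjoin_X_mul_X q.2,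
      negVars_eq_of_mem_adjoin_X_mul_X p.2] at h
  refine ⟨⟨f, hfV⟩, ?_⟩
  rw [eq_div_iff ((map_ne_zero_iff _ (IsFractionRing.injective V _)).mpr hq0), ← map_mul]
  exact congrArg _ (Subtype.ext hmul)

lemma chC_mem_CQ {ℓ : ℕ} {e : ℕ → ℕ} {i : ℕ} (hi : 1 ≤ i) (hiℓ : i ≤ ℓ) (m : ℕ) :
    chC ℓ e i m ∈ CQ ℓ e := by
  by_cases hm : m ≤ 2 * e i
  · exact Algebra.subset_adjoin ⟨i, m, hi, hiℓ, hm, rfl⟩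
  · have : chC ℓ e i m = 0 := by
      refine Finset.sum_eq_zero fun p hp => ?_
      have hp' := Finset.HasAntidiagonal.mem_antidiagonal.mp hp
      by_cases h1 : p.1 ≤ e i
      · rw [if_neg (by omega : ¬ p.2 ≤ e i), mul_zero]
      · rw [if_neg h1, zero_mul]
    rw [this]
    exact zero_mem _

/-- The chained variables are integral over the chained subalgebra. -/
lemma isIntegral_chY {ℓ : ℕ} {e : ℕ → ℕ} {i j : ℕ} (hi : 1 ≤ i) (hiℓ : i ≤ ℓ)
    (hj : j ≤ e i) : IsIntegral (CQ ℓ e) (chY ℓ e i j) := by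
  let p : Polynomial (MvPolynomial (Fin (nVars ℓ e)) ℂ) :=
    ∑ k ∈ Finset.range (e i + 1), Polynomial.monomial k (chY ℓ e i k)
  have hp : ∀ k, p.coeff k = if k ≤ e i then chY ℓ e i k else 0 := by
    intro k
    simp [p, Polynomial.coeff_monomial]
  have h := isIntegral_coeff_of_coeff_sq (R := CQ ℓ e) p (fun m => by
    have : (p ^ 2).coeff m = chC ℓ e i m := by
      rw [sq, Polynomial.coeff_mul]
      simp only [hp]
      rfl
    rw [this]
    exact isIntegral_algebraMap (x := (⟨_, chC_mem_CQ hi hiℓ m⟩ : CQ ℓ e))) j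
  rwa [hp, if_pos hj] at h

lemma nVars_eq (ℓ : ℕ) (e : ℕ → ℕ) : nVars ℓ e = (∑ k ∈ Finset.Ico 1 (ℓ + 1), e k) + 1 := by
  rw [nVars, add_comm]
  rfl

lemma sum_Ico_lt_nVars {ℓ : ℕ} (e : ℕ → ℕ) {i : ℕ} (hi : i ≤ ℓ + 1) :
    ∑ k ∈ Finset.Ico 1 i, e k < nVars ℓ e := by
  rw [nVars_eq, Nat.lt_succ_iff]
  exact Finset.sum_le_sum_of_subset (Finset.Ico_subset_Ico_right hi)

/-- Induction along the chains: a property of the variables which holds for the first one and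
propagates from the start of each chain to its members holds for all variables. -/
lemma X_induction_on_chains {ℓ : ℕ} {e : ℕ → ℕ}
    {P : MvPolynomial (Fin (nVars ℓ e)) ℂ → Prop} (h0 : P (chY ℓ e 1 0))
    (hstep : ∀ i j, 1 ≤ i → i ≤ ℓ → j ≤ e i → P (chY ℓ e i 0) → P (chY ℓ e i j))
    (a : Fin (nVars ℓ e)) : P (MvPolynomial.X a) := by
  have main : ∀ i, i ≤ ℓ → ∀ a : Fin (nVars ℓ e),
      (a : ℕ) ≤ ∑ k ∈ Finset.Ico 1 (i + 1), e k → P (MvPolynomial.X a) := by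
    intro i
    induction i with
    | zero =>
      intro _ a ha
      have ha' : (a : ℕ) = 0 := by simpa using ha
      have : chY ℓ e 1 0 = MvPolynomial.X a := by
        have hlt := a.2
        rw [ha'] at hlt
        simp only [chY, Finset.Ico_self, Finset.sum_empty, zero_add, dif_pos hlt]
        congr 1
        exact Fin.ext ha'.symm
      rwa [← this]
    | succ i ih =>
      intro hi a ha
      by_cases hle : (a : ℕ) ≤ ∑ k ∈ Finset.Ico 1 (i + 1), e k
      · exact ih (by omega) a hle
      rw [Finset.sum_Ico_succ_top (by omega)] at ha
      obtain ⟨j, hj⟩ := Nat.exists_eq_add_of_le (not_le.mp hle).le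
      have hlt := sum_Ico_lt_nVars e (show i + 1 ≤ ℓ + 1 by omega)
      have hstart := ih (by omega) ⟨_, hlt⟩ le_rfl
      have h := hstep (i + 1) j (by omega) hi (by omega) (by
        simpa only [chY, add_zero, dif_pos hlt] using hstart)
      have haj := a.2
      rw [hj] at haj
      have : chY ℓ e (i + 1) j = MvPolynomial.X a := by
        simp only [chY, dif_pos haj]
        congr 1
        exact Fin.ext hj.symm
      rwa [this] at h
  refine main ℓ le_rfl a ?_
  exact Nat.lt_succ_iff.mp (a.2.trans_eq (nVars_eq ℓ e))

lemma chY_zero_ne_zero {ℓ : ℕ} (e : ℕ → ℕ) {i : ℕ} (hi : i ≤ ℓ + 1) : chY ℓ e i 0 ≠ 0 := by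
  have h := sum_Ico_lt_nVars e hi
  simp only [chY, add_zero, dif_pos h]
  exact MvPolynomial.X_ne_zero _

lemma CQ_le_chV (ℓ : ℕ) (e : ℕ → ℕ) : CQ ℓ e ≤ chV ℓ e := by
  refine Algebra.adjoin_le ?_
  rintro _ ⟨i, m, -, -, -, rfl⟩
  refine sum_mem fun p _ => ?_
  have hY : ∀ k, (if k ≤ e i then chY ℓ e i k else 0) = 0 ∨
      ∃ a, (if k ≤ e i then chY ℓ e i k else 0) = MvPolynomial.X a := by
    intro k
    unfold chY
    split_ifs with _ h
    · exact Or.inr ⟨_, rfl⟩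
    all_goals exact Or.inl rfl
  rcases hY p.1 with h1 | ⟨a, h1⟩
  · rw [h1, zero_mul]; exact zero_mem _
  rcases hY p.2 with h2 | ⟨b, h2⟩
  · rw [h2, mul_zero]; exact zero_mem _
  rw [h1, h2]
  exact Algebra.subset_adjoin ⟨a, b, rfl⟩

/-- The field of fractions of the chained subalgebra contains all products of two variables. -/
lemma X_mul_X_mem_closure_CQ {ℓ : ℕ} (hℓ : 1 ≤ ℓ) (e : ℕ → ℕ) {F : Type*} [Field F] [CharZero F]
    (φ : MvPolynomial (Fin (nVars ℓ e)) ℂ →+* F) (hφ : Function.Injective φ)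
    (a b : Fin (nVars ℓ e)) :
    φ (MvPolynomial.X a * MvPolynomial.X b) ∈
      Subfield.closure (φ '' (CQ ℓ e : Set (MvPolynomial (Fin (nVars ℓ e)) ℂ))) := by
  set K := Subfield.closure (φ '' (CQ ℓ e : Set (MvPolynomial (Fin (nVars ℓ e)) ℂ)))
  have hne : ∀ i, i ≤ ℓ → φ (chY ℓ e i 0) ≠ 0 := fun i hi =>
    (map_ne_zero_iff φ hφ).mpr (chY_zero_ne_zero e (by omega))
  have hchain : ∀ i j, 1 ≤ i → i ≤ ℓ → j ≤ e i →
      φ (chY ℓ e i 0) * φ (chY ℓ e i j) ∈ K := by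
    intro i j hi hiℓ hj
    have h := mul_mem_of_sum_antidiagonal_mem K
      (fun k => φ (if k ≤ e i then chY ℓ e i k else 0)) (by simpa using hne i hiℓ)
      (fun m => by
        simp only [← map_mul, ← map_sum]
        exact Subfield.subset_closure ⟨_, chC_mem_CQ hi hiℓ m, rfl⟩) j
    simpa [hj] using h
  have hy0 := hne 1 hℓ
  have hsq := hchain 1 0 le_rfl hℓ (Nat.zero_le _)
  have hall : ∀ a, φ (chY ℓ e 1 0) * φ (MvPolynomial.X a) ∈ K := by
    intro a
    refine X_induction_on_chains (P := fun x => φ (chY ℓ e 1 0) * φ x ∈ K) hsq ?_ a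
    intro i j hi hiℓ hj h
    have hz := hne i hiℓ
    have := K.div_mem (K.mul_mem h (hchain i j hi hiℓ hj))
      (hchain i 0 hi hiℓ (Nat.zero_le _))
    convert this using 1
    field_simp
  have := K.div_mem (K.mul_mem (hall a) (hall b)) hsq
  rw [map_mul]
  convert this using 1
  field_simp

theorem chained_veronese_is_normalization
    (ℓ : ℕ) (hℓ : 1 ≤ ℓ) (e : ℕ → ℕ) (he : ∀ i, 1 ≤ i → i ≤ ℓ → 1 ≤ e i) :
    -- (i) every element of `V` is integral over `CQ`;
    (∀ x ∈ chV ℓ e, IsIntegral ↥(CQ ℓ e) x)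
    ∧
    -- (ii) `CQ` and `V` have the same field of fractions inside `Frac(A)`;
    (Subfield.closure
        ((algebraMap (MvPolynomial (Fin (nVars ℓ e)) ℂ)
            (FractionRing (MvPolynomial (Fin (nVars ℓ e)) ℂ))) ''
          (CQ ℓ e : Set (MvPolynomial (Fin (nVars ℓ e)) ℂ)))
      = Subfield.closure
        ((algebraMap (MvPolynomial (Fin (nVars ℓ e)) ℂ)
            (FractionRing (MvPolynomial (Fin (nVars ℓ e)) ℂ))) ''
          (chV ℓ e : Set (MvPolynomial (Fin (nVars ℓ e)) ℂ))))
    ∧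
    -- (iii) `V` is integrally closed in its field of fractions.
    IsIntegrallyClosed ↥(chV ℓ e) := by
  refine ⟨fun x hx => ?_, le_antisymm ?_ ?_, isIntegrallyClosed_adjoin_X_mul_X _⟩
  · have hX : ∀ a, IsIntegral (CQ ℓ e) (MvPolynomial.X a : MvPolynomial (Fin (nVars ℓ e)) ℂ) :=
      X_induction_on_chains (isIntegral_chY le_rfl hℓ (Nat.zero_le _))
        fun i j hi hiℓ hj _ => isIntegral_chY hi hiℓ hj
    induction hx using Algebra.adjoin_induction with
    | mem x hx => obtain ⟨a, b, rfl⟩ := hx; exact (hX a).mul (hX b)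
    | algebraMap r => exact isIntegral_algebraMap (x := algebraMap ℂ (CQ ℓ e) r)
    | add x y _ _ hx hy => exact hx.add hy
    | mul x y _ _ hx hy => exact hx.mul hy
  · exact Subfield.closure_mono (Set.image_mono (CQ_le_chV ℓ e))
  · rw [Subfield.closure_le]
    rintro _ ⟨x, hx, rfl⟩
    induction hx using Algebra.adjoin_induction with
    | mem x hx =>
      obtain ⟨a, b, rfl⟩ := hx
      exact X_mul_X_mem_closure_CQ hℓ e _ (IsFractionRing.injective _ _) a b
    | algebraMap r => exact Subfield.subset_closure ⟨_, (CQ ℓ e).algebraMap_mem r, rfl⟩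
    | add x y _ _ hx hy => rw [map_add]; exact add_mem hx hy
    | mul x y _ _ hx hy => rw [map_mul]; exact mul_mem hx hy

end
end

section
/- Let e ≥ 1. In the polynomial ring R = ℂ[y_0,…,y_e], for 0 ≤ m ≤ 2e set c_m = Σ_{i+j=m, 0≤i,j≤e} y_i y_j, let Q_e ⊆ R be the ℂ-subalgebra generated by c_0,…,c_{2e}, and let V_e ⊆ R be the degree-2 Veronese subalgebra generated by all products y_i y_j. Then for any single variable y_s (0 ≤ s ≤ e), the subalgebras Q_e[y_s] and V_e[y_s] obtained by adjoining y_s each have field of fractions equal to Frac(R), the whole ring R is integral over each of them, and the integral closure of Q_e[y_s] (respectively of V_e[y_s]) in Frac(R) equals the full polynomial ring R = ℂ[y_0,…,y_e]. In particular, the normalization of Q_e[y_s] and of V_e[y_s] is a polynomial ring. -/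
/-!
Statement 8 (single-chain case of part (2) of the paper's Lemma on chained Veronese
rings): In `R = ℂ[y₀,…,y_e]`, with `c_m = Σ_{i+j=m} y_i y_j`, `Q_e` the subalgebra
generated by `c_0, …, c_{2e}`, and `V_e` the degree-2 Veronese subalgebra, adjoining a
single variable `y_s` to `Q_e` (resp. to `V_e`) yields a subalgebra whose field of
fractions is all of `Frac(R)`, over which `R` is integral, and whose integral closure
in `Frac(R)` is the full polynomial ring `R`.  In particular the normalization of
`Q_e[y_s]` and of `V_e[y_s]` is a polynomial ring.
-/

noncomputable section

set_option synthInstance.maxHeartbeats 1000000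
set_option maxHeartbeats 1000000

/-- `V_e`: the degree-2 Veronese subalgebra of `ℂ[y₀,…,y_e]`. -/
def Ve (e : ℕ) : Subalgebra ℂ (MvPolynomial (Fin (e + 1)) ℂ) :=
  Algebra.adjoin ℂ
    {x | ∃ i j : Fin (e + 1), x = MvPolynomial.X i * MvPolynomial.X j}

/-- `Q_e[y_s]`: the subalgebra generated by `Q_e` together with the variable `y_s`. -/
def QeAdj (e : ℕ) (s : Fin (e + 1)) : Subalgebra ℂ (MvPolynomial (Fin (e + 1)) ℂ) :=
  Algebra.adjoin ℂ
    (insert (MvPolynomial.X s) (Qe e : Set (MvPolynomial (Fin (e + 1)) ℂ)))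

/-- `V_e[y_s]`: the subalgebra generated by `V_e` together with the variable `y_s`. -/
def VeAdj (e : ℕ) (s : Fin (e + 1)) : Subalgebra ℂ (MvPolynomial (Fin (e + 1)) ℂ) :=
  Algebra.adjoin ℂ
    (insert (MvPolynomial.X s) (Ve e : Set (MvPolynomial (Fin (e + 1)) ℂ)))

/-- The image of a subalgebra of `R = ℂ[y₀,…,y_e]` inside `Frac(R)`. -/
def inFrac (e : ℕ) (S : Subalgebra ℂ (MvPolynomial (Fin (e + 1)) ℂ)) :
    Subalgebra ℂ (FractionRing (MvPolynomial (Fin (e + 1)) ℂ)) :=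
  S.map (IsScalarTower.toAlgHom ℂ (MvPolynomial (Fin (e + 1)) ℂ)
    (FractionRing (MvPolynomial (Fin (e + 1)) ℂ)))

theorem yVar_of_fin (e : ℕ) (i : Fin (e + 1)) : yVar e i = MvPolynomial.X i := by
  simp [yVar, Nat.le_of_lt_succ i.isLt]

theorem Qe_le_QeAdj (e : ℕ) (s : Fin (e + 1)) : Qe e ≤ QeAdj e s :=
  fun _ hx => Algebra.subset_adjoin (Set.mem_insert_of_mem _ hx)

theorem X_mem_QeAdj (e : ℕ) (s : Fin (e + 1)) : MvPolynomial.X s ∈ QeAdj e s :=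
  Algebra.subset_adjoin (Set.mem_insert _ _)

theorem yVar_mul_yVar_mem_Ve (e i j : ℕ) : yVar e i * yVar e j ∈ Ve e := by
  by_cases hi : i ≤ e
  · by_cases hj : j ≤ e
    · simp only [yVar, hi, hj, dite_true]
      exact Algebra.subset_adjoin ⟨_, _, rfl⟩
    · rw [yVar_eq_zero (not_le.mp hj), mul_zero]
      exact zero_mem _
  · rw [yVar_eq_zero (not_le.mp hi), zero_mul]
    exact zero_mem _

theorem Qe_le_Ve (e : ℕ) : Qe e ≤ Ve e := by
  refine Algebra.adjoin_le ?_
  rintro _ ⟨m, -, rfl⟩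
  exact sum_mem fun p _ => yVar_mul_yVar_mem_Ve e p.1 p.2

theorem QeAdj_le_VeAdj (e : ℕ) (s : Fin (e + 1)) : QeAdj e s ≤ VeAdj e s :=
  Algebra.adjoin_mono (Set.insert_subset_insert (Qe_le_Ve e))

/-- If the coefficients of the square of a power series `∑ a i * t ^ i` lie in a subfield `F`,
then so do all the products `a 0 * a m`. -/
theorem Subfield.zero_mul_mem_of_antidiagonal_sum_mem {K : Type*} [Field K] (h2 : (2 : K) ≠ 0)
    (F : Subfield K) (a : ℕ → K) (ha : a 0 ≠ 0)
    (h : ∀ m, ∑ p ∈ Finset.HasAntidiagonal.antidiagonal m, a p.1 * a p.2 ∈ F) (m : ℕ) :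
    a 0 * a m ∈ F := by
  have h0 : a 0 * a 0 ∈ F := by simpa using h 0
  induction m using Nat.strong_induction_on with
  | _ m ih =>
    rcases Nat.eq_zero_or_pos m with rfl | hm
    · exact h0
    have hinner : ∑ p ∈ ((Finset.HasAntidiagonal.antidiagonal m).erase (0, m)).erase (m, 0),
        a p.1 * a p.2 ∈ F := by
      refine sum_mem fun p hp => ?_
      obtain ⟨i, j⟩ := p
      simp only [Finset.mem_erase, Finset.HasAntidiagonal.mem_antidiagonal, ne_eq,
        Prod.mk.injEq] at hp
      have hij : a i * a j = (a 0 * a i) * (a 0 * a j) / (a 0 * a 0) := by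
        field_simp
      rw [hij]
      exact div_mem (mul_mem (ih i (by omega)) (ih j (by omega))) h0
    have hsum := h m
    rw [← Finset.add_sum_erase _ _
        (show (0, m) ∈ Finset.HasAntidiagonal.antidiagonal m by simp),
      ← Finset.add_sum_erase _ _
        (show (m, 0) ∈ (Finset.HasAntidiagonal.antidiagonal m).erase (0, m) by
          simp [hm.ne'])] at hsum
    have hdouble : 2 * (a 0 * a m) ∈ F := by
      convert! sub_mem hsum hinner using 1
      ring
    have htwo : (2 : K) ∈ F := ofNat_mem F 2
    simpa [h2] using div_mem hdouble htwo

theorem closure_inFrac_QeAdj (e : ℕ) (s : Fin (e + 1)) :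
    Subfield.closure (inFrac e (QeAdj e s) :
      Set (FractionRing (MvPolynomial (Fin (e + 1)) ℂ))) = ⊤ := by
  set R := MvPolynomial (Fin (e + 1)) ℂ
  set F := Subfield.closure (inFrac e (QeAdj e s) : Set (FractionRing R))
  have hsub : ∀ x ∈ QeAdj e s, algebraMap R (FractionRing R) x ∈ F := fun x hx =>
    Subfield.subset_closure ⟨x, hx, rfl⟩
  have hX : ∀ i : Fin (e + 1), algebraMap R (FractionRing R) (MvPolynomial.X i) ≠ 0 := fun i => by
    simpa using MvPolynomial.X_ne_zero i
  have ha (i : Fin (e + 1)) : algebraMap R (FractionRing R) (yVar e i) =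
      algebraMap R (FractionRing R) (MvPolynomial.X i) := by rw [yVar_of_fin]
  have ha0 : algebraMap R (FractionRing R) (yVar e 0) ≠ 0 := by
    simpa using (ha 0).trans_ne (hX 0)
  have hmul := F.zero_mul_mem_of_antidiagonal_sum_mem two_ne_zero
    (fun i => algebraMap R (FractionRing R) (yVar e i)) ha0 fun m => by
      simpa [cCoeff] using hsub _ (Qe_le_QeAdj e s (cCoeff_mem_Qe e m))
  have hzero : algebraMap R (FractionRing R) (yVar e 0) ∈ F := by
    have := div_mem (hmul s) (hsub _ (X_mem_QeAdj e s))
    rwa [ha s, mul_div_cancel_right₀ _ (hX s)] at this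
  have hvar (i : Fin (e + 1)) : algebraMap R (FractionRing R) (MvPolynomial.X i) ∈ F := by
    have := div_mem (hmul i) hzero
    rwa [mul_div_cancel_left₀ _ ha0, ha i] at this
  have hR (x : R) : algebraMap R (FractionRing R) x ∈ F := by
    induction x using MvPolynomial.induction_on with
    | C c => exact hsub _ ((QeAdj e s).algebraMap_mem c)
    | add p q hp hq => rw [map_add]; exact add_mem hp hq
    | mul_X p i hp => rw [map_mul]; exact mul_mem hp (hvar i)
  refine eq_top_iff.mpr fun z _ => ?_
  obtain ⟨x, y, -, rfl⟩ := IsFractionRing.div_surjective R z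
  exact div_mem (hR x) (hR y)

/-- If the coefficients of the square of a polynomial lie in a subalgebra, then the coefficients
of the polynomial are integral over it. -/
theorem Polynomial.isIntegral_coeff_of_coeff_sq_mem {k R : Type*} [CommRing k] [CommRing R]
    [Algebra k R] (A : Subalgebra k R) (p : Polynomial R) (h : ∀ m, (p ^ 2).coeff m ∈ A) (i : ℕ) :
    IsIntegral A (p.coeff i) := by
  let _ := Polynomial.algebra A R
  refine Polynomial.isIntegral_iff_isIntegral_coeff.mp (IsIntegral.of_pow two_pos ?_) i
  exact Polynomial.isIntegral_iff_isIntegral_coeff.mpr fun m =>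
    isIntegral_algebraMap (x := (⟨_, h m⟩ : A))

theorem isIntegral_QeAdj (e : ℕ) (s : Fin (e + 1)) (x : MvPolynomial (Fin (e + 1)) ℂ) :
    IsIntegral (QeAdj e s) x := by
  let P : Polynomial (MvPolynomial (Fin (e + 1)) ℂ) :=
    ∑ i ∈ Finset.range (e + 1), Polynomial.monomial i (yVar e i)
  have hP (i : ℕ) : P.coeff i = yVar e i := by
    simp only [P, Polynomial.finsetSum_coeff, Polynomial.coeff_monomial, Finset.sum_ite_eq',
      Finset.mem_range]
    split_ifs with h
    · rfl
    · exact (yVar_eq_zero (by omega)).symm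
  have hvar (i : Fin (e + 1)) : IsIntegral (QeAdj e s)
      (MvPolynomial.X i : MvPolynomial (Fin (e + 1)) ℂ) := by
    rw [← yVar_of_fin, ← hP]
    refine Polynomial.isIntegral_coeff_of_coeff_sq_mem _ P (fun m => ?_) i
    simpa only [sq, Polynomial.coeff_mul, hP, cCoeff] using Qe_le_QeAdj e s (cCoeff_mem_Qe e m)
  induction x using MvPolynomial.induction_on with
  | C c => exact isIntegral_algebraMap (x := algebraMap ℂ (QeAdj e s) c)
  | add p q hp hq => exact hp.add hq
  | mul_X p i hp => exact hp.mul (hvar i)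

theorem isIntegral_of_subalgebra_le {k R : Type*} [CommRing k] [CommRing R] [Algebra k R]
    {A B : Subalgebra k R} (h : A ≤ B) {x : R} (hx : IsIntegral A x) : IsIntegral B x :=
  hx.map_of_comp_eq (Subalgebra.inclusion h).toRingHom (RingHom.id R) rfl

theorem isIntegral_inFrac_iff (e : ℕ) (S : Subalgebra ℂ (MvPolynomial (Fin (e + 1)) ℂ))
    (hS : ∀ x : MvPolynomial (Fin (e + 1)) ℂ, IsIntegral S x)
    (x : FractionRing (MvPolynomial (Fin (e + 1)) ℂ)) :
    IsIntegral (inFrac e S) x ↔ x ∈ (algebraMap (MvPolynomial (Fin (e + 1)) ℂ)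
      (FractionRing (MvPolynomial (Fin (e + 1)) ℂ))).range := by
  set R := MvPolynomial (Fin (e + 1)) ℂ
  constructor
  · intro hx
    let f := IsScalarTower.toAlgHom ℂ R (FractionRing R)
    refine IsIntegrallyClosed.isIntegral_iff.mp ?_
    have hle : inFrac e S ≤ f.range := by
      rintro _ ⟨y, -, rfl⟩
      exact ⟨y, rfl⟩
    let g := AlgEquiv.ofInjective f (IsFractionRing.injective R (FractionRing R))
    refine hx.map_of_comp_eq (g.symm.toAlgHom.comp (Subalgebra.inclusion hle)).toRingHom
      (RingHom.id _) (RingHom.ext fun a => ?_)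
    exact congrArg Subtype.val (g.apply_symm_apply (Subalgebra.inclusion hle a))
  · rintro ⟨y, rfl⟩
    exact (hS y).map_of_comp_eq
      ((IsScalarTower.toAlgHom ℂ R (FractionRing R)).subalgebraMap S).toRingHom
      (algebraMap R (FractionRing R)) rfl

theorem normalization_of_Qe_adjoin_variable_is_polynomial_ring
    (e : ℕ) (he : 1 ≤ e) (s : Fin (e + 1)) :
    -- `Q_e[y_s]` has field of fractions `Frac(R)`:
    (Subfield.closure ((inFrac e (QeAdj e s) :
        Set (FractionRing (MvPolynomial (Fin (e + 1)) ℂ)))) = ⊤)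
    ∧
    -- `R` is integral over `Q_e[y_s]`:
    (∀ x : MvPolynomial (Fin (e + 1)) ℂ, IsIntegral ↥(QeAdj e s) x)
    ∧
    -- the integral closure of `Q_e[y_s]` in `Frac(R)` is exactly `R`:
    (∀ x : FractionRing (MvPolynomial (Fin (e + 1)) ℂ),
      IsIntegral ↥(inFrac e (QeAdj e s)) x ↔
        x ∈ (algebraMap (MvPolynomial (Fin (e + 1)) ℂ)
              (FractionRing (MvPolynomial (Fin (e + 1)) ℂ))).range)
    ∧
    -- `V_e[y_s]` has field of fractions `Frac(R)`:
    (Subfield.closure ((inFrac e (VeAdj e s) :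
        Set (FractionRing (MvPolynomial (Fin (e + 1)) ℂ)))) = ⊤)
    ∧
    -- `R` is integral over `V_e[y_s]`:
    (∀ x : MvPolynomial (Fin (e + 1)) ℂ, IsIntegral ↥(VeAdj e s) x)
    ∧
    -- the integral closure of `V_e[y_s]` in `Frac(R)` is exactly `R`:
    (∀ x : FractionRing (MvPolynomial (Fin (e + 1)) ℂ),
      IsIntegral ↥(inFrac e (VeAdj e s)) x ↔
        x ∈ (algebraMap (MvPolynomial (Fin (e + 1)) ℂ)
              (FractionRing (MvPolynomial (Fin (e + 1)) ℂ))).range) := by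
  have hQ := isIntegral_QeAdj e s
  have hV (x : MvPolynomial (Fin (e + 1)) ℂ) : IsIntegral (VeAdj e s) x :=
    isIntegral_of_subalgebra_le (QeAdj_le_VeAdj e s) (hQ x)
  refine ⟨closure_inFrac_QeAdj e s, hQ, isIntegral_inFrac_iff e _ hQ, ?_, hV,
    isIntegral_inFrac_iff e _ hV⟩
  rw [eq_top_iff, ← closure_inFrac_QeAdj e s]
  exact Subfield.closure_mono (Subalgebra.map_mono (QeAdj_le_VeAdj e s))

end
end
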